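/- Let K ⊆ ℝ^d be a convex set, μ > 0, G ≥ 0 and m > 0. Suppose F, F′ : K → ℝ are two μ-strongly convex functions on K such that F − F′ is G-Lipschitz on K, and that e^{−mF} and e^{−mF′} are integrable on K. Let P be the probability measure on K with density proportional to e^{−mF} and Q the probability measure on K with density proportional to e^{−mF′}. Then for all λ > 1, D_λ(P‖Q) ≤ λ·m·G²/(2μ). -/

import Mathlib

open MeasureTheory ProbabilityTheory Real

/-- The Rényi divergence of order `l` between measures `P` and `Q`:
`D_l(P‖Q) = (1/(l−1))·log ∫ (dP/dQ)^l dQ`. -/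
noncomputable def renyiDiv {Y : Type*} [MeasurableSpace Y] (P Q : Measure Y) (l : ℝ) : ℝ :=
  (l - 1)⁻¹ * Real.log (∫ y, (P.rnDeriv Q y).toReal ^ l ∂Q)

/-- A pair of probability measures `(P, Q)` satisfies `δ`-approximate `ρ`-CDP:
there exist probability measures `P', P'', Q', Q''` with `P = (1−δ)P' + δP''` and
`Q = (1−δ)Q' + δQ''` such that `D_l(P'‖Q') ≤ ρ·l` and `D_l(Q'‖P') ≤ ρ·l` for all `l > 1`. -/
def IsApproxCDPPair {Y : Type*} [MeasurableSpace Y] (P Q : Measure Y) (ρ δ : ℝ) : Prop :=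
  ∃ P' P'' Q' Q'' : Measure Y,
    IsProbabilityMeasure P' ∧ IsProbabilityMeasure P'' ∧
      IsProbabilityMeasure Q' ∧ IsProbabilityMeasure Q'' ∧
      P = ENNReal.ofReal (1 - δ) • P' + ENNReal.ofReal δ • P'' ∧
      Q = ENNReal.ofReal (1 - δ) • Q' + ENNReal.ofReal δ • Q'' ∧
      ∀ l : ℝ, 1 < l → renyiDiv P' Q' l ≤ ρ * l ∧ renyiDiv Q' P' l ≤ ρ * l

/-- The unnormalized Gibbs measure on `K` with potential `m·F`: the measure on `ℝ^d` with
density `e^{−m·F}` restricted to `K`. -/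
noncomputable def unnormGibbs {d : ℕ} (K : Set (EuclideanSpace ℝ (Fin d))) (m : ℝ)
    (F : EuclideanSpace ℝ (Fin d) → ℝ) : Measure (EuclideanSpace ℝ (Fin d)) :=
  (volume.restrict K).withDensity fun x => ENNReal.ofReal (Real.exp (-(m * F x)))

/-- The Gibbs probability measure on `K` with density proportional to `e^{−m·F}`. -/
noncomputable def gibbs {d : ℕ} (K : Set (EuclideanSpace ℝ (Fin d))) (m : ℝ)
    (F : EuclideanSpace ℝ (Fin d) → ℝ) : Measure (EuclideanSpace ℝ (Fin d)) :=
  (unnormGibbs K m F Set.univ)⁻¹ • unnormGibbs K m F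


open scoped ENNReal Pointwise

lemma bm_compact (A B C : Set ℝ) (hA : IsCompact A) (hB : IsCompact B) (hAn : A.Nonempty)
    (hBn : B.Nonempty) (h : ∀ x ∈ A, ∀ y ∈ B, x + y ∈ C) :
    volume A + volume B ≤ volume C := by
  obtain ⟨p, hp, hpA⟩ := hA.exists_isGreatest hAn
  obtain ⟨q, hq, hqB⟩ := hB.exists_isLeast hBn
  have h1 : volume ((fun x => q + x) '' A) = volume A := by
    simp
  have h2 : volume ((fun x => p + x) '' B) = volume B := by
    simp
  have hm : MeasurableSet ((fun x => p + x) '' B) :=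
    (hB.image (by fun_prop)).isClosed.measurableSet
  have hd : AEDisjoint volume ((fun x => q + x) '' A) ((fun x => p + x) '' B) := by
    refine measure_mono_null (t := {p + q}) ?_ (by simp)
    rintro z ⟨⟨x, hx, rfl⟩, ⟨y, hy, hxy⟩⟩
    have := hpA hx
    have := hqB hy
    simp only at hxy
    simp only [Set.mem_singleton_iff]
    linarith
  rw [← h1, ← h2, ← measure_union₀ hm.nullMeasurableSet hd]
  apply measure_mono
  rintro z (⟨x, hx, rfl⟩ | ⟨y, hy, rfl⟩)
  · simpa [add_comm] using h x hx q hq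
  · exact h p hp y hy

lemma bm_meas (A B C : Set ℝ) (hA : MeasurableSet A) (hB : MeasurableSet B) (hAn : A.Nonempty)
    (hBn : B.Nonempty) (h : ∀ x ∈ A, ∀ y ∈ B, x + y ∈ C) :
    volume A + volume B ≤ volume C := by
  by_cases hC : volume C = ∞
  · simp [hC]
  obtain ⟨p, hp⟩ := hAn
  obtain ⟨q, hq⟩ := hBn
  have hAC : volume A ≤ volume C := by
    have h1 : volume ((fun x => q + x) '' A) = volume A := by simp
    rw [← h1]
    apply measure_mono
    rintro z ⟨x, hx, rfl⟩
    simpa [add_comm] using h x hx q hq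
  have hBC : volume B ≤ volume C := by
    have h1 : volume ((fun x => p + x) '' B) = volume B := by simp
    rw [← h1]
    apply measure_mono
    rintro z ⟨x, hx, rfl⟩
    exact h p hp x hx
  refine ENNReal.le_of_forall_pos_le_add fun ε hε _ => ?_
  have hε' : ((ε / 2 : NNReal) : ℝ≥0∞) ≠ 0 := by
    simpa using hε.ne'
  obtain ⟨K, hKA, hK, hKv⟩ := hA.exists_isCompact_lt_add (ne_top_of_le_ne_top hC hAC) hε'
  obtain ⟨L, hLB, hL, hLv⟩ := hB.exists_isCompact_lt_add (ne_top_of_le_ne_top hC hBC) hε'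
  have key := bm_compact (insert p K) (insert q L) C (hK.insert p) (hL.insert q) (by simp) (by simp)
    (by
      intro x hx y hy
      refine h x ?_ y ?_
      · exact Set.insert_subset hp hKA hx
      · exact Set.insert_subset hq hLB hy)
  calc volume A + volume B ≤ (volume K + (ε / 2 : NNReal)) + (volume L + (ε / 2 : NNReal)) := by
        gcongr
    _ = (volume K + volume L) + ((ε / 2 + ε / 2 : NNReal) : ℝ≥0∞) := by
        push_cast; ring
    _ ≤ (volume (insert p K) + volume (insert q L)) + ε := by
        rw [add_halves]
        gcongr <;> simp
    _ ≤ volume C + ε := by gcongr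

lemma bm_weighted (a b : ℝ) (ha : 0 < a) (hb : 0 < b)
    (A B C : Set ℝ) (hA : MeasurableSet A) (hB : MeasurableSet B) (hAn : A.Nonempty)
    (hBn : B.Nonempty) (h : ∀ x ∈ A, ∀ y ∈ B, a * x + b * y ∈ C) :
    ENNReal.ofReal a * volume A + ENNReal.ofReal b * volume B ≤ volume C := by
  have key := bm_meas (a • A) (b • B) C (hA.const_smul_of_ne_zero ha.ne')
    (hB.const_smul_of_ne_zero hb.ne') hAn.smul_set hBn.smul_set (by
      rintro _ ⟨x, hx, rfl⟩ _ ⟨y, hy, rfl⟩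
      exact h x hx y hy)
  simpa [Measure.addHaar_smul, abs_of_pos ha, abs_of_pos hb] using key

lemma layer (f : ℝ → ℝ≥0∞) (hf : Measurable f) (hf1 : ∀ x, f x ≤ 1) :
    ∫⁻ x, f x = ∫⁻ t in Set.Ioo (0:ℝ) 1, volume {x | ENNReal.ofReal t < f x} := by
  have h1 : ∀ x, f x = ENNReal.ofReal (f x).toReal := fun x =>
    (ENNReal.ofReal_toReal (ne_top_of_le_ne_top ENNReal.one_ne_top (hf1 x))).symm
  calc ∫⁻ x, f x = ∫⁻ x, ENNReal.ofReal (f x).toReal := lintegral_congr h1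
    _ = ∫⁻ t in Set.Ioi (0:ℝ), volume {x | t < (f x).toReal} :=
      lintegral_eq_lintegral_meas_lt _ (Filter.Eventually.of_forall fun x => ENNReal.toReal_nonneg)
        hf.ennreal_toReal.aemeasurable
    _ = ∫⁻ t in Set.Ioi (0:ℝ), (Set.Ioo (0:ℝ) 1).indicator
          (fun t => volume {x | ENNReal.ofReal t < f x}) t := by
      refine setLIntegral_congr_fun measurableSet_Ioi fun t ht => ?_
      have ht : 0 < t := ht
      by_cases h : t < 1
      · rw [Set.indicator_of_mem (by exact ⟨ht, h⟩)]
        congr 1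
        ext x
        simp only [Set.mem_ofPred_eq]
        rw [ENNReal.ofReal_lt_iff_lt_toReal ht.le
          (ne_top_of_le_ne_top ENNReal.one_ne_top (hf1 x))]
      · rw [Set.indicator_of_notMem (by rintro ⟨_, h'⟩; exact h h')]
        convert measure_empty (μ := (volume : Measure ℝ))
        ext x
        simp only [Set.mem_ofPred_eq, Set.mem_empty_iff_false, iff_false, not_lt]
        have := ENNReal.toReal_mono ENNReal.one_ne_top (hf1 x)
        simp at this
        linarith
    _ = _ := by
      rw [setLIntegral_indicator measurableSet_Ioo]
      congr 2
      ext t; simp only [Set.mem_inter_iff, Set.mem_Ioo, Set.mem_Ioi]; tauto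

lemma pl_norm (a b : ℝ) (ha : 0 < a) (hb : 0 < b) (f g h : ℝ → ℝ≥0∞)
    (hf : Measurable f) (hg : Measurable g) (hh : Measurable h)
    (hf1 : ⨆ x, f x = 1) (hg1 : ⨆ x, g x = 1) (hh1 : ∀ x, h x ≤ 1)
    (H : ∀ x y t, t < f x → t < g y → t < h (a * x + b * y)) :
    ENNReal.ofReal a * (∫⁻ x, f x) + ENNReal.ofReal b * (∫⁻ x, g x) ≤ ∫⁻ x, h x := by
  have hm : ∀ f : ℝ → ℝ≥0∞, Measurable fun t : ℝ => volume {x | ENNReal.ofReal t < f x} := by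
    intro f
    refine Antitone.measurable fun s t hst => measure_mono fun x hx => ?_
    exact lt_of_le_of_lt (ENNReal.ofReal_le_ofReal hst) hx
  rw [layer f hf (fun x => hf1 ▸ le_iSup f x), layer g hg (fun x => hg1 ▸ le_iSup g x),
    layer h hh hh1, ← lintegral_const_mul _ (hm f), ← lintegral_const_mul _ (hm g),
    ← lintegral_add_left ((hm f).const_mul _)]
  refine setLIntegral_mono (hm h) fun t ht => ?_
  have ht1 : ENNReal.ofReal t < 1 := by simpa using ht.2
  refine bm_weighted a b ha hb _ _ _ (measurableSet_lt measurable_const hf)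
    (measurableSet_lt measurable_const hg) ?_ ?_ ?_
  · exact lt_iSup_iff.1 (hf1 ▸ ht1)
  · exact lt_iSup_iff.1 (hg1 ▸ ht1)
  · intro x hx y hy
    exact H x y _ hx hy

lemma amgm (a b : ℝ) (ha : 0 < a) (hb : 0 < b) (hab : a + b = 1) (x y : ℝ≥0∞) :
    x ^ a * y ^ b ≤ ENNReal.ofReal a * x + ENNReal.ofReal b * y := by
  by_cases hx : x = ∞
  · simp [hx, ha, ENNReal.mul_top]
  by_cases hy : y = ∞
  · simp [hy, hb, ENNReal.mul_top]
  lift x to NNReal using hx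
  lift y to NNReal using hy
  rw [← ENNReal.coe_rpow_of_nonneg _ ha.le, ← ENNReal.coe_rpow_of_nonneg _ hb.le]
  have := NNReal.geom_mean_le_arith_mean2_weighted a.toNNReal b.toNNReal x y (by
    rw [← Real.toNNReal_add ha.le hb.le, hab]; simp)
  rw [Real.coe_toNNReal a ha.le, Real.coe_toNNReal b hb.le] at this
  unfold ENNReal.ofReal
  exact_mod_cast this

lemma pl_bdd (a b : ℝ) (ha : 0 < a) (hb : 0 < b) (hab : a + b = 1) (f g h : ℝ → ℝ≥0∞)
    (hf : Measurable f) (hg : Measurable g) (hh : Measurable h)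
    (hf1 : ⨆ x, f x ≠ ∞) (hg1 : ⨆ x, g x ≠ ∞)
    (H : ∀ x y, f x ^ a * g y ^ b ≤ h (a * x + b * y)) :
    (∫⁻ x, f x) ^ a * (∫⁻ x, g x) ^ b ≤ ∫⁻ x, h x := by
  set M := ⨆ x, f x with hM
  set N := ⨆ x, g x with hN
  by_cases hM0 : M = 0
  · have : ∀ x, f x = 0 := fun x => by
      have := le_iSup f x
      rw [← hM, hM0] at this
      simpa using this
    simp [this, ha]
  by_cases hN0 : N = 0
  · have : ∀ x, g x = 0 := fun x => by
      have := le_iSup g x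
      rw [← hN, hN0] at this
      simpa using this
    simp [this, hb]
  set c := M ^ a * N ^ b with hc
  have hc0 : c ≠ 0 := by
    simp [hc, hM0, hN0, hf1, hg1]
  have hct : c ≠ ∞ := by
    apply ENNReal.mul_ne_top <;> apply ENNReal.rpow_ne_top_of_nonneg <;> first | assumption | positivity
  have hab' : ∀ t : ℝ≥0∞, t ^ a * t ^ b = t := fun t => by
    rw [← ENNReal.rpow_add_of_nonneg _ _ ha.le hb.le, hab, ENNReal.rpow_one]
  have key := pl_norm a b ha hb (fun x => M⁻¹ * f x) (fun x => N⁻¹ * g x)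
    (fun x => min (c⁻¹ * h x) 1) (hf.const_mul _) (hg.const_mul _)
    ((hh.const_mul _).min measurable_const)
    (by rw [← ENNReal.mul_iSup, ← hM, ENNReal.inv_mul_cancel hM0 hf1])
    (by rw [← ENNReal.mul_iSup, ← hN, ENNReal.inv_mul_cancel hN0 hg1])
    (fun x => min_le_right _ _)
    (by
      intro x y t htf htg
      have h1 : M⁻¹ * f x ≤ 1 := by
        rw [← ENNReal.inv_mul_cancel hM0 hf1]
        gcongr; exact le_iSup f x
      refine lt_min ?_ (htf.trans_le h1)
      calc t = t ^ a * t ^ b := (hab' t).symm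
        _ < (M⁻¹ * f x) ^ a * (N⁻¹ * g y) ^ b :=
          ENNReal.mul_lt_mul (ENNReal.rpow_lt_rpow htf ha) (ENNReal.rpow_lt_rpow htg hb)
        _ = c⁻¹ * (f x ^ a * g y ^ b) := by
          rw [ENNReal.mul_rpow_of_nonneg _ _ ha.le, ENNReal.mul_rpow_of_nonneg _ _ hb.le, hc,
            ENNReal.mul_inv (by left; simp [hM0, hf1]) (by right; simp [hN0, hg1]), ENNReal.inv_rpow, ENNReal.inv_rpow]
          ring
        _ ≤ _ := by gcongr; exact H x y)
  have k2 := (amgm a b ha hb hab _ _).trans key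
  have k3 : ∫⁻ x, min (c⁻¹ * h x) 1 ≤ c⁻¹ * ∫⁻ x, h x := by
    rw [← lintegral_const_mul _ hh]
    exact lintegral_mono fun x => min_le_left _ _
  replace k2 := k2.trans k3
  rw [lintegral_const_mul _ hf, lintegral_const_mul _ hg, ENNReal.mul_rpow_of_nonneg _ _ ha.le,
    ENNReal.mul_rpow_of_nonneg _ _ hb.le, ENNReal.inv_rpow, ENNReal.inv_rpow, mul_mul_mul_comm,
    ← ENNReal.mul_inv (by left; simp [hM0, hf1]) (by right; simp [hN0, hg1]), ← hc] at k2
  exact (ENNReal.mul_le_mul_iff_right (by simpa using hct) (by simpa using hc0)).1 k2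

/-- The Prékopa–Leindler property for weights `a`, `b`. -/
def PL (a b : ℝ) (E : Type*) [AddCommGroup E] [Module ℝ E] [MeasureSpace E] : Prop :=
  ∀ f g h : E → ℝ≥0∞, Measurable f → Measurable g → Measurable h →
    (∀ x y, f x ^ a * g y ^ b ≤ h (a • x + b • y)) →
    (∫⁻ x, f x) ^ a * (∫⁻ x, g x) ^ b ≤ ∫⁻ x, h x

lemma lintegral_min_nat (f : ℝ → ℝ≥0∞) (hf : Measurable f) :
    Filter.Tendsto (fun n : ℕ => ∫⁻ x, min (f x) n) Filter.atTop (nhds (∫⁻ x, f x)) := by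
  refine lintegral_tendsto_of_tendsto_of_monotone
    (fun n => (hf.min measurable_const).aemeasurable) ?_ ?_
  · refine Filter.Eventually.of_forall fun x m n hmn => ?_
    have : (m : ℝ≥0∞) ≤ n := by exact_mod_cast hmn
    exact min_le_min le_rfl this
  · refine Filter.Eventually.of_forall fun x => ?_
    have := (tendsto_const_nhds (x := f x)).min ENNReal.tendsto_nat_nhds_top
    simpa using this

lemma pl_real (a b : ℝ) (ha : 0 < a) (hb : 0 < b) (hab : a + b = 1) : PL a b ℝ := by
  intro f g h hf hg hh H
  have key : ∀ n : ℕ, ∀ k : ℕ,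
      (∫⁻ x, min (f x) n) ^ a * (∫⁻ x, min (g x) k) ^ b ≤ ∫⁻ x, h x := by
    intro n k
    refine pl_bdd a b ha hb hab _ _ h (hf.min measurable_const) (hg.min measurable_const) hh ?_ ?_ ?_
    · exact ne_top_of_le_ne_top (ENNReal.natCast_ne_top n) (iSup_le fun x => min_le_right _ _)
    · exact ne_top_of_le_ne_top (ENNReal.natCast_ne_top k) (iSup_le fun x => min_le_right _ _)
    · intro x y
      refine le_trans ?_ (H x y)
      gcongr <;> exact min_le_left _ _
  have mono : ∀ (f : ℝ → ℝ≥0∞), Measurable f → ∫⁻ x, f x = ⨆ n : ℕ, ∫⁻ x, min (f x) n := by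
    intro f hf
    refine tendsto_nhds_unique (lintegral_min_nat f hf) (tendsto_atTop_iSup ?_)
    intro m n hmn
    have : (m : ℝ≥0∞) ≤ n := by exact_mod_cast hmn
    exact lintegral_mono fun x => min_le_min le_rfl this
  have hr : ∀ (c : ℝ), 0 < c → ∀ (f : ℝ → ℝ≥0∞), Measurable f →
      (∫⁻ x, f x) ^ c = ⨆ n : ℕ, (∫⁻ x, min (f x) n) ^ c := by
    intro c hc f hf
    rw [mono f hf]
    exact (ENNReal.orderIsoRpow c hc).map_iSup _
  rw [hr a ha f hf, hr b hb g hg, ENNReal.iSup_mul]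
  refine iSup_le fun n => ?_
  rw [ENNReal.mul_iSup]
  exact iSup_le fun k => key n k

lemma pl_prod (a b : ℝ) (E F : Type*) [AddCommGroup E] [Module ℝ E] [MeasureSpace E]
    [AddCommGroup F] [Module ℝ F] [MeasureSpace F] [SFinite (volume : Measure F)]
    [SFinite (volume : Measure E)]
    (hE : PL a b E) (hF : PL a b F) : PL a b (E × F) := by
  intro f g h hf hg hh H
  rw [Measure.volume_eq_prod, lintegral_prod _ hf.aemeasurable, lintegral_prod _ hg.aemeasurable,
    lintegral_prod _ hh.aemeasurable]
  refine hE _ _ _ hf.lintegral_prod_right' hg.lintegral_prod_right' hh.lintegral_prod_right' ?_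
  intro x y
  refine hF _ _ _ (hf.comp measurable_prodMk_left) (hg.comp measurable_prodMk_left)
    (hh.comp measurable_prodMk_left) ?_
  intro u v
  exact H (x, u) (y, v)

lemma pl_equiv (a b : ℝ) (E F : Type*) [AddCommGroup E] [Module ℝ E] [MeasureSpace E]
    [AddCommGroup F] [Module ℝ F] [MeasureSpace F] (e : E → F) (he : MeasurePreserving e)
    (hadd : ∀ x y, e (a • x + b • y) = a • e x + b • e y)
    (hE : PL a b E) : PL a b F := by
  intro f g h hf hg hh H
  rw [← he.lintegral_comp hf, ← he.lintegral_comp hg, ← he.lintegral_comp hh]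
  refine hE _ _ _ (hf.comp he.measurable) (hg.comp he.measurable) (hh.comp he.measurable) ?_
  intro x y
  simp only [Function.comp, hadd]
  exact H _ _

lemma pl_pi (a b : ℝ) (ha : 0 < a) (hb : 0 < b) (hab : a + b = 1) (n : ℕ) :
    PL a b (Fin n → ℝ) := by
  induction n with
  | zero =>
    intro f g h hf hg hh H
    rw [volume_pi, Measure.pi_of_empty, lintegral_dirac, lintegral_dirac, lintegral_dirac]
    convert H _ _
  | succ n ih =>
    refine pl_equiv a b (ℝ × (Fin n → ℝ)) _
      (MeasurableEquiv.piFinSuccAbove (fun _ => ℝ) 0).symm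
      (volume_preserving_piFinSuccAbove (fun _ => ℝ) 0).symm ?_
      (pl_prod a b _ _ (pl_real a b ha hb hab) ih)
    intro x y
    ext i
    refine Fin.cases ?_ (fun j => ?_) i <;> simp [MeasurableEquiv.piFinSuccAbove]

lemma pl_euclidean (a b : ℝ) (ha : 0 < a) (hb : 0 < b) (hab : a + b = 1) (n : ℕ) :
    PL a b (EuclideanSpace ℝ (Fin n)) :=
  pl_equiv a b (Fin n → ℝ) _ (WithLp.toLp 2) (PiLp.volume_preserving_toLp (Fin n))
    (fun x y => by simp) (pl_pi a b ha hb hab n)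

lemma exponent_bound (μ G m l r Fx Fy Fz F'x F'y : ℝ) (hμ : 0 < μ) (hm : 0 < m) (hl : 1 < l)
    (hsc : Fz ≤ l⁻¹ * Fx + ((l - 1) / l) * Fy - l⁻¹ * ((l - 1) / l) * (μ / 2 * r ^ 2))
    (hL : |(Fx - F'x) - (Fy - F'y)| ≤ G * r) :
    (-(m * (l * Fx - (l - 1) * F'x))) * l⁻¹ + (-(m * F'y)) * ((l - 1) / l)
      ≤ (l - 1) * m * G ^ 2 / (2 * μ) + -(m * Fz) := by
  have hl0 : 0 < l := by linarith
  have h1 : -(G * r) ≤ (Fx - F'x) - (Fy - F'y) := (abs_le.1 hL).1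
  set b := (l - 1) / l with hb
  set a := l⁻¹ with ha
  have hb0 : 0 < b := div_pos (by linarith) hl0
  have ha0 : 0 < a := inv_pos.2 hl0
  have hab : a + b = 1 := by rw [ha, hb]; field_simp; ring
  have hla : l * a = 1 := by rw [ha]; field_simp
  have hlb : (l - 1) * a = b := by rw [ha, hb]; field_simp
  have e1 : (-(m * (l * Fx - (l - 1) * F'x))) * a = -(m * Fx) + m * b * F'x := by
    linear_combination (-(m * Fx)) * hla + m * F'x * hlb
  have e2 : b * G * r - a * b * (μ / 2 * r ^ 2) ≤ (l - 1) * G ^ 2 / (2 * μ) := by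
    rw [le_div_iff₀ (by positivity)]
    have : b * G * r * (2 * μ) - a * b * (μ / 2 * r ^ 2) * (2 * μ)
        = (l - 1) * G ^ 2 - (l - 1) * (G - a * μ * r) ^ 2 := by
      rw [← hlb]; ring
    have h3 : 0 ≤ (l - 1) * (G - a * μ * r) ^ 2 :=
      mul_nonneg (by linarith) (sq_nonneg _)
    linarith
  have e3 : (l - 1) * m * G ^ 2 / (2 * μ) = m * ((l - 1) * G ^ 2 / (2 * μ)) := by ring
  rw [e1, e3]
  have h4 : m * b * (-(G * r)) ≤ m * b * ((Fx - F'x) - (Fy - F'y)) := by gcongr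
  have h5 : m * (b * G * r - a * b * (μ / 2 * r ^ 2)) ≤ m * ((l - 1) * G ^ 2 / (2 * μ)) := by
    gcongr
  have h6 : m * Fz ≤ m * (a * Fx + b * Fy - a * b * (μ / 2 * r ^ 2)) := by gcongr
  have h7 : m * Fx = m * (a + b) * Fx := by rw [hab]; ring
  nlinarith

lemma gibbs_pl {d : ℕ} (K : Set (EuclideanSpace ℝ (Fin d)))
    (μ G m : ℝ) (hμ : 0 < μ) (hm : 0 < m)
    (F F' : EuclideanSpace ℝ (Fin d) → ℝ)
    (hF : StrongConvexOn K μ F)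
    (hFmeas : Measurable F) (hF'meas : Measurable F')
    (hLip : ∀ x ∈ K, ∀ y ∈ K, |(F x - F' x) - (F y - F' y)| ≤ G * ‖x - y‖)
    (l : ℝ) (hl : 1 < l) (hKo : MeasurableSet K) :
    (∫⁻ x in K, ENNReal.ofReal (Real.exp (-(m * (l * F x - (l - 1) * F' x))))) *
      (∫⁻ x in K, ENNReal.ofReal (Real.exp (-(m * F' x)))) ^ (l - 1) ≤
    ENNReal.ofReal (Real.exp (l * ((l - 1) * m * G ^ 2 / (2 * μ)))) *
      (∫⁻ x in K, ENNReal.ofReal (Real.exp (-(m * F x)))) ^ l := by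
  have hl0 : 0 < l := by linarith
  have hb0 : 0 < (l - 1) / l := div_pos (by linarith) hl0
  have ha0 : 0 < l⁻¹ := inv_pos.2 hl0
  have hab : l⁻¹ + (l - 1) / l = 1 := by field_simp; ring
  have key := pl_euclidean l⁻¹ ((l - 1) / l) ha0 hb0 hab d
    (K.indicator fun x => ENNReal.ofReal (Real.exp (-(m * (l * F x - (l - 1) * F' x)))))
    (K.indicator fun x => ENNReal.ofReal (Real.exp (-(m * F' x))))
    (K.indicator fun x => ENNReal.ofReal (Real.exp ((l - 1) * m * G ^ 2 / (2 * μ))) *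
      ENNReal.ofReal (Real.exp (-(m * F x))))
    (Measurable.indicator (by fun_prop) hKo) (Measurable.indicator (by fun_prop) hKo)
    (Measurable.indicator (by fun_prop) hKo)
    (by
      intro x y
      by_cases hx : x ∈ K
      swap
      · simp [hx, ha0]
      by_cases hy : y ∈ K
      swap
      · simp [hy, hb0]
      have hz := hF.1 hx hy ha0.le hb0.le hab
      rw [Set.indicator_of_mem hx, Set.indicator_of_mem hy, Set.indicator_of_mem hz,
        ENNReal.ofReal_rpow_of_pos (Real.exp_pos _), ENNReal.ofReal_rpow_of_pos (Real.exp_pos _),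
        ← ENNReal.ofReal_mul (by positivity), ← ENNReal.ofReal_mul (by positivity),
        ← Real.exp_mul, ← Real.exp_mul, ← Real.exp_add, ← Real.exp_add]
      refine ENNReal.ofReal_le_ofReal (Real.exp_le_exp.2 ?_)
      exact exponent_bound μ G m l ‖x - y‖ _ _ _ _ _ hμ hm hl
        (hF.2 hx hy ha0.le hb0.le hab) (hLip x hx y hy))
  rw [lintegral_indicator hKo, lintegral_indicator hKo, lintegral_indicator hKo,
    lintegral_const_mul _ (by fun_prop)] at key
  have k2 := ENNReal.rpow_le_rpow key hl0.le
  rw [ENNReal.mul_rpow_of_nonneg _ _ hl0.le, ENNReal.mul_rpow_of_nonneg _ _ hl0.le,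
    ← ENNReal.rpow_mul, ← ENNReal.rpow_mul, inv_mul_cancel₀ hl0.ne', div_mul_cancel₀ _ hl0.ne',
    ENNReal.rpow_one, ENNReal.ofReal_rpow_of_pos (Real.exp_pos _), ← Real.exp_mul,
    mul_comm _ l] at k2
  exact k2

lemma final_aux {X : Type*} [MeasurableSpace X] (ν : Measure X) [SigmaFinite ν]
    (m l c : ℝ) (hl : 1 < l) (hc : 0 ≤ c) (F F' : X → ℝ) (hF : Measurable F) (hF' : Measurable F')
    (Z B : ℝ) (hZ : 0 < Z) (hB : 0 < B)
    (hQ : IsFiniteMeasure (ν.withDensity fun x => ENNReal.ofReal (Real.exp (-(m * F' x)))))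
    (H : (∫⁻ x, ENNReal.ofReal (Real.exp (-(m * (l * F x - (l - 1) * F' x)))) ∂ν) *
      ENNReal.ofReal B ^ (l - 1) ≤
      ENNReal.ofReal (Real.exp (l * ((l - 1) * c))) * ENNReal.ofReal Z ^ l) :
    renyiDiv
      ((ENNReal.ofReal Z)⁻¹ • ν.withDensity fun x => ENNReal.ofReal (Real.exp (-(m * F x))))
      ((ENNReal.ofReal B)⁻¹ • ν.withDensity fun x => ENNReal.ofReal (Real.exp (-(m * F' x)))) l
      ≤ l * c := by
  set Q0 := ν.withDensity fun x => ENNReal.ofReal (Real.exp (-(m * F' x))) with hQ0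
  set ρ : X → ℝ := fun x => B / Z * Real.exp (-(m * (F x - F' x))) with hρ
  have hρm : Measurable ρ := by fun_prop
  have hρ0 : ∀ x, 0 < ρ x := fun x => by positivity
  have hP : ((ENNReal.ofReal Z)⁻¹ • ν.withDensity fun x => ENNReal.ofReal (Real.exp (-(m * F x))))
      = ((ENNReal.ofReal B)⁻¹ • Q0).withDensity fun x => ENNReal.ofReal (ρ x) := by
    rw [withDensity_smul_measure, hQ0, ← withDensity_mul _ (by fun_prop) (by fun_prop),
      ← withDensity_smul _ (by fun_prop), ← withDensity_smul _ (by fun_prop)]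
    congr 1
    ext x
    simp only [Pi.smul_apply, Pi.mul_apply, smul_eq_mul]
    rw [← ENNReal.ofReal_inv_of_pos hZ, ← ENNReal.ofReal_inv_of_pos hB,
      ← ENNReal.ofReal_mul (by positivity), ← ENNReal.ofReal_mul (by positivity),
      ← ENNReal.ofReal_mul (by positivity)]
    congr 1
    have : Real.exp (-(m * F x)) = Real.exp (-(m * F' x)) * Real.exp (-(m * (F x - F' x))) := by
      rw [← Real.exp_add]; congr 1; ring
    rw [this, hρ]
    field_simp
  have hfin : IsFiniteMeasure ((ENNReal.ofReal B)⁻¹ • Q0) :=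
    Measure.smul_finite _ (by simpa using hB)
  unfold renyiDiv
  rw [hP]
  have hI : ∫ y, ((((ENNReal.ofReal B)⁻¹ • Q0).withDensity fun x => ENNReal.ofReal (ρ x)).rnDeriv
      ((ENNReal.ofReal B)⁻¹ • Q0) y).toReal ^ l ∂((ENNReal.ofReal B)⁻¹ • Q0)
      = ∫ y, ρ y ^ l ∂((ENNReal.ofReal B)⁻¹ • Q0) := by
    apply integral_congr_ae
    filter_upwards [Measure.rnDeriv_withDensity ((ENNReal.ofReal B)⁻¹ • Q0)
      (hρm.ennreal_ofReal)] with x hx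
    rw [hx, ENNReal.toReal_ofReal (hρ0 x).le]
  rw [hI]
  have hlin : ∫⁻ y, ENNReal.ofReal (ρ y ^ l) ∂((ENNReal.ofReal B)⁻¹ • Q0)
      ≤ ENNReal.ofReal (Real.exp (l * ((l - 1) * c))) := by
    rw [lintegral_smul_measure, hQ0, lintegral_withDensity_eq_lintegral_mul _ (by fun_prop)
      (by fun_prop)]
    have e : ∀ x, ((fun x => ENNReal.ofReal (Real.exp (-(m * F' x)))) *
        fun y => ENNReal.ofReal (ρ y ^ l)) x = ENNReal.ofReal ((B / Z) ^ l) *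
          ENNReal.ofReal (Real.exp (-(m * (l * F x - (l - 1) * F' x)))) := by
      intro x
      simp only [Pi.mul_apply]
      rw [← ENNReal.ofReal_mul (by positivity), ← ENNReal.ofReal_mul (by positivity), hρ,
        Real.mul_rpow (by positivity) (by positivity), ← Real.exp_mul, mul_left_comm,
        ← Real.exp_add]
      congr 3
      ring
    rw [lintegral_congr e, lintegral_const_mul _ (by fun_prop), smul_eq_mul]
    set A := ∫⁻ x, ENNReal.ofReal (Real.exp (-(m * (l * F x - (l - 1) * F' x)))) ∂ν
    rw [ENNReal.ofReal_rpow_of_pos hB, ENNReal.ofReal_rpow_of_pos hZ] at H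
    have e2 : (ENNReal.ofReal B)⁻¹ * (ENNReal.ofReal ((B / Z) ^ l) * A)
        = ENNReal.ofReal ((Z ^ l)⁻¹) * (A * ENNReal.ofReal (B ^ (l - 1))) := by
      have : B⁻¹ * (B / Z) ^ l = (Z ^ l)⁻¹ * B ^ (l - 1) := by
        rw [Real.div_rpow hB.le hZ.le, Real.rpow_sub_one hB.ne']
        field_simp
      rw [← ENNReal.ofReal_inv_of_pos hB, ← mul_assoc, ← ENNReal.ofReal_mul (by positivity), this,
        ENNReal.ofReal_mul (by positivity)]
      ring
    rw [e2]
    calc _ ≤ ENNReal.ofReal ((Z ^ l)⁻¹) * (ENNReal.ofReal (Real.exp (l * ((l - 1) * c))) *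
            ENNReal.ofReal (Z ^ l)) := by gcongr
      _ = _ := by
        have hZl : 0 < Z ^ l := by positivity
        rw [← ENNReal.ofReal_mul (by positivity), ← ENNReal.ofReal_mul (by positivity)]
        congr 1
        field_simp
  have hle : ∫ y, ρ y ^ l ∂((ENNReal.ofReal B)⁻¹ • Q0) ≤ Real.exp (l * ((l - 1) * c)) := by
    rw [integral_eq_lintegral_of_nonneg_ae
      (Filter.Eventually.of_forall fun x => Real.rpow_nonneg (hρ0 x).le _)
      (hρm.pow_const l).aestronglyMeasurable]
    exact ENNReal.toReal_le_of_le_ofReal (Real.exp_pos _).le hlin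
  have hnn : 0 ≤ ∫ y, ρ y ^ l ∂((ENNReal.ofReal B)⁻¹ • Q0) :=
    integral_nonneg fun x => Real.rpow_nonneg (hρ0 x).le _
  have hl1 : 0 < l - 1 := by linarith
  have hlog : Real.log (∫ y, ρ y ^ l ∂((ENNReal.ofReal B)⁻¹ • Q0)) ≤ l * ((l - 1) * c) := by
    rcases hnn.eq_or_lt with h0 | h0
    · rw [← h0, Real.log_zero]; positivity
    · exact (Real.log_le_iff_le_exp h0).2 hle
  rw [inv_mul_le_iff₀ hl1]
  linarith

/-- Rényi divergence bound for strongly log-concave Gibbs measures (Gopi–Lee–Liang): if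
`F, F′` are `μ`-strongly convex on a convex set `K ⊆ ℝ^d` and `F − F′` is `G`-Lipschitz on
`K`, then the probability measures `P ∝ e^{−mF}` and `Q ∝ e^{−mF′}` on `K` satisfy
`D_l(P‖Q) ≤ l·m·G²/(2μ)` for all `l > 1`. -/
theorem gibbs_renyi_bound (d : ℕ) (K : Set (EuclideanSpace ℝ (Fin d))) (hK : Convex ℝ K)
    (μ G m : ℝ) (hμ : 0 < μ) (hG : 0 ≤ G) (hm : 0 < m)
    (F F' : EuclideanSpace ℝ (Fin d) → ℝ)
    (hF : StrongConvexOn K μ F) (hF' : StrongConvexOn K μ F')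
    (hFmeas : Measurable F) (hF'meas : Measurable F')
    (hLip : ∀ x ∈ K, ∀ y ∈ K, |(F x - F' x) - (F y - F' y)| ≤ G * ‖x - y‖)
    (hInt : IntegrableOn (fun x => Real.exp (-(m * F x))) K volume)
    (hInt' : IntegrableOn (fun x => Real.exp (-(m * F' x))) K volume)
    (hpos : unnormGibbs K m F Set.univ ≠ 0) (hpos' : unnormGibbs K m F' Set.univ ≠ 0)
    (l : ℝ) (hl : 1 < l) :
    renyiDiv (gibbs K m F) (gibbs K m F') l ≤ l * m * G ^ 2 / (2 * μ) := by
  have hres : (volume.restrict K : Measure (EuclideanSpace ℝ (Fin d)))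
      = volume.restrict (interior K) :=
    Measure.restrict_congr_set
      (interior_ae_eq_of_null_frontier (hK.addHaar_frontier volume)).symm
  have hfinite : ∀ F : EuclideanSpace ℝ (Fin d) → ℝ,
      IntegrableOn (fun x => Real.exp (-(m * F x))) K volume →
      IsFiniteMeasure (unnormGibbs K m F) := by
    intro F hI
    exact isFiniteMeasure_withDensity_ofReal hI.2
  have hval : ∀ F : EuclideanSpace ℝ (Fin d) → ℝ,
      IntegrableOn (fun x => Real.exp (-(m * F x))) K volume →
      unnormGibbs K m F Set.univ ≠ 0 →
      0 < (unnormGibbs K m F Set.univ).toReal ∧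
      ENNReal.ofReal (unnormGibbs K m F Set.univ).toReal = unnormGibbs K m F Set.univ ∧
      unnormGibbs K m F Set.univ = ∫⁻ x in interior K, ENNReal.ofReal (Real.exp (-(m * F x))) := by
    intro F hI h0
    have := hfinite F hI
    refine ⟨ENNReal.toReal_pos h0 (measure_ne_top _ _), ENNReal.ofReal_toReal (measure_ne_top _ _), ?_⟩
    unfold unnormGibbs
    rw [withDensity_apply _ MeasurableSet.univ, Measure.restrict_univ, hres]
  obtain ⟨z1, z2, z3⟩ := hval F hInt hpos
  obtain ⟨b1, b2, b3⟩ := hval F' hInt' hpos'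
  have hFi : StrongConvexOn (interior K) μ F :=
    ⟨hK.interior, fun x hx y hy => hF.2 (interior_subset hx) (interior_subset hy)⟩
  have key := gibbs_pl (interior K) μ G m hμ hm F F' hFi hFmeas hF'meas
    (fun x hx y hy => hLip x (interior_subset hx) y (interior_subset hy)) l hl
    isOpen_interior.measurableSet
  rw [← z3, ← b3, ← z2, ← b2] at key
  have hfin : IsFiniteMeasure ((volume.restrict (interior K)).withDensity
      fun x => ENNReal.ofReal (Real.exp (-(m * F' x)))) := by
    have := hfinite F' hInt'
    unfold unnormGibbs at this
    rwa [hres] at this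
  have fin := final_aux (volume.restrict (interior K)) m l (m * G ^ 2 / (2 * μ)) hl
    (by positivity) F F' hFmeas hF'meas _ _ z1 b1 hfin (by
      convert key using 5
      ring)
  rw [z2, b2] at fin
  unfold gibbs
  calc _ = _ := by
        congr 2
        · unfold unnormGibbs; rw [hres]
        · unfold unnormGibbs; rw [hres]
    _ ≤ _ := fin
    _ = _ := by ring
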